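/- arXiv:1711.03330 — 6 statements merged into one kernel-verified Lean document; each statement's English description precedes it below -/
import Mathlib

section
/- Let V be a complex vector space, T : V → V a linear map, μ a nonzero complex number, and k a natural number. Suppose ỹ₀, ỹ₁, …, ỹ_k ∈ V satisfy T ỹ₀ = μ ỹ₀ and, for each j with 1 ≤ j ≤ k, T ỹⱼ − μ ỹⱼ = μ · Σ_{i=0}^{j−1} (1/(j−i)!) ỹᵢ. Then there exist vectors y₀, y₁, …, y_k ∈ V such that y₀ = c·ỹ₀ for some nonzero complex scalar c, each yⱼ lies in the linear span of {ỹ₀, …, ỹⱼ}, T y₀ = μ y₀, and T yⱼ − μ yⱼ = y_{j−1} for each j with 1 ≤ j ≤ k. -/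
/-- Vectors `ỹ₀, …, ỹ_k` satisfying the triangular relations
`T ỹⱼ − μ ỹⱼ = μ Σ_{i<j} ỹᵢ/(j−i)!` under a linear map `T` (with `T ỹ₀ = μ ỹ₀`, `μ ≠ 0`)
can be recombined into an honest Jordan chain `y₀, …, y_k` for `T` at the eigenvalue `μ`,
with `y₀` a nonzero multiple of `ỹ₀` and each `yⱼ` in the span of `ỹ₀, …, ỹⱼ`. -/
theorem stmt_5 {V : Type*} [AddCommGroup V] [Module ℂ V]
    (T : V →ₗ[ℂ] V) (μ : ℂ) (hμ : μ ≠ 0) (k : ℕ) (ty : ℕ → V)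
    (h0 : T (ty 0) = μ • ty 0)
    (h : ∀ j : ℕ, 1 ≤ j → j ≤ k →
      T (ty j) - μ • ty j
        = μ • ∑ i ∈ Finset.range j, (((j - i).factorial : ℂ))⁻¹ • ty i) :
    ∃ y : ℕ → V, ∃ c : ℂ, c ≠ 0 ∧ y 0 = c • ty 0 ∧
      (∀ j : ℕ, j ≤ k → y j ∈ Submodule.span ℂ (ty '' {i : ℕ | i ≤ j})) ∧
      T (y 0) = μ • y 0 ∧
      (∀ j : ℕ, 1 ≤ j → j ≤ k → T (y j) - μ • y j = y (j - 1)) := by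
  classical
  let N : V →ₗ[ℂ] V := T - μ • LinearMap.id
  have hN : ∀ x, N x = T x - μ • x := fun x => by simp [N]
  let S : ℕ → Submodule ℂ V := fun n => Submodule.span ℂ (ty '' {i : ℕ | i < n})
  have hmem : ∀ i n, i < n → ty i ∈ S n := fun i n hi =>
    Submodule.subset_span ⟨i, hi, rfl⟩
  have hA : ∀ n, n ≤ k → ∀ x ∈ S (n + 1), N x ∈ S n := by
    intro n hn x hx
    have hle : S (n + 1) ≤ (S n).comap N := by
      refine Submodule.span_le.2 ?_
      rintro _ ⟨i, hi, rfl⟩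
      have hi' : i < n + 1 := hi
      change N (ty i) ∈ S n
      rw [hN]
      rcases Nat.eq_zero_or_pos i with rfl | hpos
      · rw [h0, sub_self]
        exact (S n).zero_mem
      · rw [h i hpos (by omega)]
        refine (S n).smul_mem _ ((S n).sum_mem fun l hl => (S n).smul_mem _ (hmem l n ?_))
        have := Finset.mem_range.1 hl
        omega
    exact hle hx
  have hB : ∀ j, j + 1 ≤ k → N (ty (j + 1)) - μ • ty j ∈ S j := by
    intro j hj
    rw [hN, h (j + 1) (by omega) hj, Finset.sum_range_succ]
    have : ((j + 1 - j).factorial : ℂ)⁻¹ = 1 := by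
      simp
    rw [this, one_smul, smul_add, add_sub_cancel_right]
    exact (S j).smul_mem _ ((S j).sum_mem fun l hl =>
      (S j).smul_mem _ (hmem l j (Finset.mem_range.1 hl)))
  have hC : ∀ m j, m + j = k → (N ^ m) (ty k) - μ ^ m • ty j ∈ S j := by
    intro m
    induction m with
    | zero =>
      intro j hj
      have : j = k := by omega
      subst this
      simp
    | succ m ih =>
      intro j hj
      have h1 := hA j (by omega) _ (ih (j + 1) (by omega))
      have h2 := (S j).smul_mem (μ ^ m) (hB j (by omega))
      have h3 := (S j).add_mem h1 h2
      have e : N ((N ^ m) (ty k) - μ ^ m • ty (j + 1)) + μ ^ m • (N (ty (j + 1)) - μ • ty j)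
          = (N ^ (m + 1)) (ty k) - μ ^ (m + 1) • ty j := by
        rw [pow_succ' N, Module.End.mul_apply, map_sub, map_smul, smul_sub, smul_smul, ← pow_succ]
        abel
      rwa [e] at h3
  have hy0 : (N ^ (k - 0)) (ty k) = μ ^ k • ty 0 := by
    have := hC k 0 (by omega)
    simpa [S, sub_eq_zero] using this
  refine ⟨fun j => (N ^ (k - j)) (ty k), μ ^ k, pow_ne_zero _ hμ, hy0, ?_, ?_, ?_⟩
  · intro j hj
    have h1 := hC (k - j) j (by omega)
    have h2 : S j ≤ Submodule.span ℂ (ty '' {i : ℕ | i ≤ j}) :=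
      Submodule.span_mono (Set.image_mono fun i (hi : i < j) => le_of_lt hi)
    have h3 : ty j ∈ Submodule.span ℂ (ty '' {i : ℕ | i ≤ j}) :=
      Submodule.subset_span ⟨j, le_refl j, rfl⟩
    have h4 := Submodule.add_mem _ (h2 h1) (Submodule.smul_mem _ (μ ^ (k - j)) h3)
    rwa [sub_add_cancel] at h4
  · change T ((N ^ (k - 0)) (ty k)) = μ • (N ^ (k - 0)) (ty k)
    rw [hy0, map_smul, h0, smul_comm]
  · intro j h1 hj
    change T ((N ^ (k - j)) (ty k)) - μ • (N ^ (k - j)) (ty k) = (N ^ (k - (j - 1))) (ty k)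
    have : k - (j - 1) = (k - j) + 1 := by omega
    rw [this, pow_succ' N, Module.End.mul_apply, hN]
end

section
/- Let α₁ and α₂ be real numbers with α₁ ≠ 0, let M be the 4×4 real matrix with rows (0, 0, 0, −α₁), (0, 0, α₁, 0), (0, −α₁, 0, −α₂), (α₁, 0, α₂, 0), and let A₀ be the 4×4 matrix with ones on the superdiagonal and zeros elsewhere. Let K, L, B be symmetric 4×4 real matrices, let g₀ = (1, 0, 0, 0)ᵀ, and suppose g₁, g₂, g₃ ∈ ℝ⁴ satisfy M·A₀·g₁ + K·g₀ = 0, M·A₀·g₂ + K·g₁ + L·g₀ = 0, and M·A₀·g₃ + K·g₂ + L·g₁ + B·g₀ = 0. Then: (a) Σ_{j=1}^{3} g₁ⱼ·K₀ⱼ + L₀₀ = 0, which is equivalent to L₀₀ + K₂₀²/α₁ + α₂·K₁₀²/α₁² − 2·K₁₀·K₃₀/α₁ = 0; and (b) Σ_{j=1}^{3} g₂ⱼ·K₀ⱼ + Σ_{j=0}^{3} g₁ⱼ·L₀ⱼ + B₀₀ = 0. -/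
open Matrix

/-- Solvability conditions (5.22) and (5.24) of the paper: from the projected expansions
`M·A₀·g₁ + K·g₀ = 0`, `M·A₀·g₂ + K·g₁ + L·g₀ = 0`, `M·A₀·g₃ + K·g₂ + L·g₁ + B·g₀ = 0`
one obtains (a) `Σ_{j=1}^{3} g₁ⱼK₀ⱼ + L₀₀ = 0`, equivalently
`L₀₀ + K₂₀²/α₁ + α₂K₁₀²/α₁² − 2K₁₀K₃₀/α₁ = 0`, and
(b) `Σ_{j=1}^{3} g₂ⱼK₀ⱼ + Σ_{j=0}^{3} g₁ⱼL₀ⱼ + B₀₀ = 0`. -/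
theorem stmt_9 (α₁ α₂ : ℝ) (hα₁ : α₁ ≠ 0)
    (M A₀ K L B : Matrix (Fin 4) (Fin 4) ℝ)
    (hM : M = !![0, 0, 0, -α₁;
                 0, 0, α₁, 0;
                 0, -α₁, 0, -α₂;
                 α₁, 0, α₂, 0])
    (hA₀ : A₀ = !![0, 1, 0, 0;
                   0, 0, 1, 0;
                   0, 0, 0, 1;
                   0, 0, 0, 0])
    (hK : K.IsSymm) (hL : L.IsSymm) (hB : B.IsSymm)
    (g₀ g₁ g₂ g₃ : Fin 4 → ℝ)
    (hg₀ : g₀ = ![1, 0, 0, 0])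
    (heq1 : (M * A₀) *ᵥ g₁ + K *ᵥ g₀ = 0)
    (heq2 : (M * A₀) *ᵥ g₂ + K *ᵥ g₁ + L *ᵥ g₀ = 0)
    (heq3 : (M * A₀) *ᵥ g₃ + K *ᵥ g₂ + L *ᵥ g₁ + B *ᵥ g₀ = 0) :
    (g₁ 1 * K 0 1 + g₁ 2 * K 0 2 + g₁ 3 * K 0 3 + L 0 0 = 0) ∧
      (L 0 0 + (K 2 0) ^ 2 / α₁ + α₂ * (K 1 0) ^ 2 / α₁ ^ 2 - 2 * K 1 0 * K 3 0 / α₁ = 0) ∧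
      (g₂ 1 * K 0 1 + g₂ 2 * K 0 2 + g₂ 3 * K 0 3 +
        (g₁ 0 * L 0 0 + g₁ 1 * L 0 1 + g₁ 2 * L 0 2 + g₁ 3 * L 0 3) + B 0 0 = 0) := by
  subst hM hA₀ hg₀
  have a0 := congrFun heq1 0
  have a1 := congrFun heq1 1
  have a2 := congrFun heq1 2
  have a3 := congrFun heq1 3
  have b0 := congrFun heq2 0
  have c0 := congrFun heq3 0
  simp [Matrix.mulVec, dotProduct, Fin.sum_univ_four, Matrix.vecHead] at a0 a1 a2 a3 b0 c0
  have k1 := hK.apply 0 1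
  have k2 := hK.apply 0 2
  have k3 := hK.apply 0 3
  simp only [a0, zero_mul, zero_add] at b0 c0
  have ha : g₁ 1 * K 0 1 + g₁ 2 * K 0 2 + g₁ 3 * K 0 3 + L 0 0 = 0 := by linarith
  refine ⟨ha, ?_, by linarith⟩
  have e3 : g₁ 3 = -K 1 0 / α₁ := by field_simp; linarith
  have e2 : g₁ 2 = K 2 0 / α₁ := by field_simp; linarith
  have e1 : g₁ 1 = (-K 3 0 - α₂ * g₁ 3) / α₁ := by field_simp; linarith
  rw [← ha, e1, e2, e3, ← k1, ← k2, ← k3]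
  field_simp
  ring
end

section
/- Let c₀, α₁, α₂ be real numbers with c₀ ≠ 0 and α₁ ≠ 0, let M be the 4×4 real matrix with rows (0, 0, 0, −α₁), (0, 0, α₁, 0), (0, −α₁, 0, −α₂), (α₁, 0, α₂, 0), and let A₀ be the 4×4 matrix with ones on the superdiagonal and zeros elsewhere. Let K be a symmetric 4×4 real matrix, g₀ = (1, 0, 0, 0)ᵀ, and g₁ ∈ ℝ⁴ with M·A₀·g₁ + K·g₀ = 0. Suppose f₁, f₂ ∈ ℝ⁴ satisfy c₀·M·A₀·f₁ = M·g₀ and M·A₀·(2c₀·f₂ + f₁) + c₀·K·f₁ = M·g₁. Then f₁ has components f₁₁ = 1/c₀, f₁₂ = 0, f₁₃ = 0 (its component f₁₀ being unconstrained), and f₂₃ = (K₂₀ − K₁₁ − c₀·f₁₀·K₁₀)/(2·α₁·c₀). -/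
open Matrix

/-- Projected forms of the constraint `𝓛(c·∂_c X_tw) = ∂_τ X_tw`:
from `c₀·M·A₀·f₁ = M·g₀` and `M·A₀·(2c₀f₂ + f₁) + c₀·K·f₁ = M·g₁` one obtains
`f₁ = (f₁₀, 1/c₀, 0, 0)ᵀ` and the formula (5.30) for `f₂₃`. -/
theorem stmt_10 (c₀ α₁ α₂ : ℝ) (hc₀ : c₀ ≠ 0) (hα₁ : α₁ ≠ 0)
    (M A₀ K : Matrix (Fin 4) (Fin 4) ℝ)
    (hM : M = !![0, 0, 0, -α₁;
                 0, 0, α₁, 0;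
                 0, -α₁, 0, -α₂;
                 α₁, 0, α₂, 0])
    (hA₀ : A₀ = !![0, 1, 0, 0;
                   0, 0, 1, 0;
                   0, 0, 0, 1;
                   0, 0, 0, 0])
    (hK : K.IsSymm)
    (g₀ g₁ f₁ f₂ : Fin 4 → ℝ)
    (hg₀ : g₀ = ![1, 0, 0, 0])
    (hg₁ : (M * A₀) *ᵥ g₁ + K *ᵥ g₀ = 0)
    (hf₁ : c₀ • ((M * A₀) *ᵥ f₁) = M *ᵥ g₀)
    (hf₂ : (M * A₀) *ᵥ ((2 * c₀) • f₂ + f₁) + c₀ • (K *ᵥ f₁) = M *ᵥ g₁) :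
    f₁ 1 = 1 / c₀ ∧ f₁ 2 = 0 ∧ f₁ 3 = 0 ∧
      f₂ 3 = (K 2 0 - K 1 1 - c₀ * f₁ 0 * K 1 0) / (2 * α₁ * c₀) := by
  have key : ∀ x : Fin 4 → ℝ, (M * A₀) *ᵥ x = ![0, α₁ * x 3, -α₁ * x 2, α₁ * x 1 + α₂ * x 3] := by
    intro x
    rw [← Matrix.mulVec_mulVec]
    subst hM hA₀
    ext i
    fin_cases i <;> simp [Matrix.mulVec, dotProduct, Fin.sum_univ_four]
  rw [key] at hg₁ hf₁ hf₂
  have a1 := congrFun hf₁ 1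
  have a2 := congrFun hf₁ 2
  have a3 := congrFun hf₁ 3
  have b := congrFun hg₁ 2
  have d := congrFun hf₂ 1
  clear hg₁ hf₁ hf₂ key
  subst hM hg₀
  simp [Matrix.mulVec, dotProduct, Fin.sum_univ_four, hc₀, hα₁] at a1 a2 a3 b d
  simp only [a1, a2, mul_zero, add_zero] at a3 d
  have e : f₁ 1 = 1 / c₀ := by
    rw [eq_div_iff hc₀]
    apply mul_left_cancel₀ hα₁
    linear_combination a3
  refine ⟨e, a2, a1, ?_⟩
  have e' : c₀ * f₁ 1 = 1 := by rw [e]; field_simp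
  rw [eq_div_iff (by positivity)]
  linear_combination d - b - K 1 1 * e'
end

section
/- Let α₁ and α₂ be complex numbers with α₁ ≠ 0, let M be the 4×4 complex matrix with rows (0, 0, 0, −α₁), (0, 0, α₁, 0), (0, −α₁, 0, −α₂), (α₁, 0, α₂, 0), and let A₀ be the 4×4 matrix with ones on the superdiagonal and zeros elsewhere. Let K and L be symmetric 4×4 complex matrices, let λ₁, λ₂, λ₃, λ₄ ∈ ℂ, and let C₀, C₁, C₂, C₃, C₄ ∈ ℂ⁴ satisfy C₀ = (1, 0, 0, 0)ᵀ together with: M·A₀·C₁ = λ₁·M·C₀; M·A₀·C₂ + K·C₀ = M·(λ₁·C₁ + λ₂·C₀); M·A₀·C₃ + K·C₁ = M·(λ₁·C₂ + λ₂·C₁ + λ₃·C₀); and M·A₀·C₄ + K·C₂ + L·C₀ = M·(λ₁·C₃ + λ₂·C₂ + λ₃·C₁ + λ₄·C₀). Then α₁·λ₁⁴ + (2·K₂₀ − K₁₁)·λ₁² + (L₀₀ + K₂₀²/α₁ + α₂·K₁₀²/α₁² − 2·K₁₀·K₃₀/α₁) = 0. -/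
open Matrix

/-- The computational heart of Theorem 5.1: projecting the expanded eigenvalue problem
`λZ = 𝓛Z` (with `λ = ε^{1/2}λ₁ + ελ₂ + …`) onto the four-dimensional generalized kernel
yields the quartic relation
`α₁λ₁⁴ + (2K₂₀ − K₁₁)λ₁² + (L₀₀ + K₂₀²/α₁ + α₂K₁₀²/α₁² − 2K₁₀K₃₀/α₁) = 0`. -/
theorem stmt_11 (α₁ α₂ : ℂ) (hα₁ : α₁ ≠ 0)
    (M A₀ K L : Matrix (Fin 4) (Fin 4) ℂ)
    (hM : M = !![0, 0, 0, -α₁;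
                 0, 0, α₁, 0;
                 0, -α₁, 0, -α₂;
                 α₁, 0, α₂, 0])
    (hA₀ : A₀ = !![0, 1, 0, 0;
                   0, 0, 1, 0;
                   0, 0, 0, 1;
                   0, 0, 0, 0])
    (hK : K.IsSymm) (hL : L.IsSymm)
    (l₁ l₂ l₃ l₄ : ℂ) (C₀ C₁ C₂ C₃ C₄ : Fin 4 → ℂ)
    (hC₀ : C₀ = ![1, 0, 0, 0])
    (h1 : (M * A₀) *ᵥ C₁ = l₁ • (M *ᵥ C₀))
    (h2 : (M * A₀) *ᵥ C₂ + K *ᵥ C₀ = M *ᵥ (l₁ • C₁ + l₂ • C₀))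
    (h3 : (M * A₀) *ᵥ C₃ + K *ᵥ C₁ = M *ᵥ (l₁ • C₂ + l₂ • C₁ + l₃ • C₀))
    (h4 : (M * A₀) *ᵥ C₄ + K *ᵥ C₂ + L *ᵥ C₀
        = M *ᵥ (l₁ • C₃ + l₂ • C₂ + l₃ • C₁ + l₄ • C₀)) :
    α₁ * l₁ ^ 4 + (2 * K 2 0 - K 1 1) * l₁ ^ 2 +
      (L 0 0 + (K 2 0) ^ 2 / α₁ + α₂ * (K 1 0) ^ 2 / α₁ ^ 2
        - 2 * K 1 0 * K 3 0 / α₁) = 0 := by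
  have k1 : K 0 1 = K 1 0 := hK.apply 1 0
  have k2 : K 0 2 = K 2 0 := hK.apply 2 0
  have k3 : K 0 3 = K 3 0 := hK.apply 3 0
  subst hM hA₀ hC₀
  have a1 := congrFun h1 1
  have a2 := congrFun h1 2
  have a3 := congrFun h1 3
  have b0 := congrFun h2 0
  have b1 := congrFun h2 1
  have b2 := congrFun h2 2
  have b3 := congrFun h2 3
  have c1 := congrFun h3 1
  have d0 := congrFun h4 0
  clear h1 h2 h3 h4
  simp [Matrix.mulVec, dotProduct, Fin.sum_univ_four, Matrix.mul_apply, hα₁] at a1 a2 a3 b0 b1 b2 b3 c1 d0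
  simp only [Matrix.vecHead, Matrix.mulVec, dotProduct, Fin.sum_univ_four] at d0
  rw [a1] at b0 b2 d0
  rw [a2] at b1
  rw [k1, k2, k3, b0] at d0
  have e1 : C₁ 1 = l₁ := by
    apply mul_left_cancel₀ hα₁
    first
      | linear_combination a3
      | (rw [a1] at a3; linear_combination a3)
  rw [e1] at b2
  rw [e1, a1, a2] at c1
  have f3 : C₂ 3 = -K 1 0 / α₁ := by
    field_simp
    linear_combination b1
  have f2 : C₂ 2 = l₁ ^ 2 + K 2 0 / α₁ := by
    field_simp
    linear_combination -b2
  have f1 : C₂ 1 = l₁ * C₁ 0 + l₂ - K 3 0 / α₁ + α₂ * K 1 0 / α₁ ^ 2 := by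
    apply mul_left_cancel₀ hα₁
    rw [f3, a2] at b3
    field_simp at b3 ⊢
    linear_combination b3
  have g3 : C₃ 3 = l₁ * C₂ 2 - (K 1 0 * C₁ 0 + K 1 1 * l₁) / α₁ := by
    field_simp
    linear_combination c1
  rw [g3, f1, f2, f3] at d0
  field_simp at d0 ⊢
  linear_combination d0
end

section
/- Let c be a nonzero real number, W : ℝ → ℝ a function, φ : ℝ → ℝ a twice continuously differentiable function, and Λ : ℕ → ℝ a sequence. Assume: (i) the function ξ ↦ (1 + ξ²)·φ(ξ) is integrable on ℝ; (ii) the functions ξ ↦ W(φ(ξ)) and ξ ↦ ξ²·W(φ(ξ)) are integrable on ℝ; (iii) Σ_{m=1}^{∞} m²·|Λ(m)| < ∞; (iv) ξ·φ(ξ) → 0 and ξ²·φ'(ξ) → 0 as ξ → +∞ and as ξ → −∞; (v) for every ξ ∈ ℝ, c²·φ''(ξ) + 2·W(φ(ξ)) − W(φ(ξ+1)) − W(φ(ξ−1)) + Σ_{m=1}^{∞} Λ(m)·(2·φ(ξ) − φ(ξ+m) − φ(ξ−m)) = 0. Then (c² − Σ_{m=1}^{∞} m²·Λ(m)) · ∫_ℝ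 φ(ξ) dξ = ∫_ℝ W(φ(ξ)) dξ. -/
open MeasureTheory Filter Topology

theorem aux_tsum {F : ℕ → ℝ → ℝ} (hF : ∀ i, Integrable (F i))
    (hs : Summable fun i => ∫ a, ‖F i a‖)
    (hm : AEStronglyMeasurable (fun a => ∑' i, F i a) volume) :
    Integrable (fun a => ∑' i, F i a) := by
  refine ⟨hm, ?_⟩
  have h1 : ∫⁻ a, ‖∑' i, F i a‖ₑ ≤ ∫⁻ a, ∑' i, ‖F i a‖ₑ :=
    lintegral_mono fun a => enorm_tsum_le_tsum_enorm
  refine lt_of_le_of_lt h1 ?_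
  rw [lintegral_tsum (fun i => (hF i).1.enorm)]
  have (i : ℕ) : ∫⁻ a, ‖F i a‖ₑ = ‖∫ a, ‖F i a‖‖ₑ := by
    rw [← ofReal_integral_norm_eq_lintegral_enorm (hF i),
      Real.enorm_of_nonneg (integral_nonneg (fun a ↦ norm_nonneg (F i a)))]
  rw [funext this]
  exact lt_top_iff_ne_top.2
    (ENNReal.tsum_coe_ne_top_iff_summable.2 <| NNReal.summable_coe.1 hs.abs)

theorem aux_one {f : ℝ → ℝ} (h0 : Integrable f) (h2 : Integrable fun x => x ^ 2 * f x) :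
    Integrable fun x => x * f x := by
  refine (h0.norm.add h2.norm).mono' (by
    exact (continuous_id.aestronglyMeasurable).mul h0.1) ?_
  refine Eventually.of_forall fun x => ?_
  simp only [Pi.add_apply, norm_mul, Real.norm_eq_abs, abs_pow]
  nlinarith [mul_nonneg (sq_nonneg (|x| - 1)) (abs_nonneg (f x)), abs_nonneg (f x),
    mul_nonneg (sq_nonneg (|x|)) (abs_nonneg (f x))]

theorem aux_shift {f : ℝ → ℝ} (h0 : Integrable f) (h2 : Integrable fun x => x ^ 2 * f x)
    (a : ℝ) : (Integrable fun x => x ^ 2 * f (x + a)) ∧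
    ∫ x, x ^ 2 * f (x + a) =
      (∫ x, x ^ 2 * f x) - 2 * a * (∫ x, x * f x) + a ^ 2 * ∫ x, f x := by
  have h1 := aux_one h0 h2
  have hi : Integrable fun x => x ^ 2 * f x - 2 * a * (x * f x) + a ^ 2 * f x :=
    (h2.sub (h1.const_mul _)).add (h0.const_mul _)
  have e : (fun x => x ^ 2 * f (x + a)) =
      fun x => (fun x => x ^ 2 * f x - 2 * a * (x * f x) + a ^ 2 * f x) (x + a) := by
    funext x; ring
  rw [e]
  refine ⟨hi.comp_add_right a, ?_⟩
  rw [integral_add_right_eq_self (fun x => x ^ 2 * f x - 2 * a * (x * f x) + a ^ 2 * f x) a]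
  have hj : Integrable fun x => x ^ 2 * f x - 2 * a * (x * f x) := h2.sub (h1.const_mul _)
  rw [integral_add hj (h0.const_mul _),
    integral_sub h2 (h1.const_mul _), integral_const_mul, integral_const_mul]

theorem aux_second {f : ℝ → ℝ} (h0 : Integrable f) (h2 : Integrable fun x => x ^ 2 * f x)
    (a : ℝ) : (Integrable fun x => x ^ 2 * (2 * f x - f (x + a) - f (x - a))) ∧
    ∫ x, x ^ 2 * (2 * f x - f (x + a) - f (x - a)) = - 2 * a ^ 2 * ∫ x, f x := by
  obtain ⟨i1, e1⟩ := aux_shift h0 h2 a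
  obtain ⟨i2, e2⟩ := aux_shift h0 h2 (-a)
  have e : (fun x => x ^ 2 * (2 * f x - f (x + a) - f (x - a))) =
      fun x => 2 * (x ^ 2 * f x) - x ^ 2 * f (x + a) - x ^ 2 * f (x + -a) := by
    funext x; rw [← sub_eq_add_neg]; ring
  rw [e]
  refine ⟨((h2.const_mul 2).sub i1).sub i2, ?_⟩
  have hj : Integrable fun x => 2 * (x ^ 2 * f x) - x ^ 2 * f (x + a) := (h2.const_mul 2).sub i1
  rw [integral_sub hj i2, integral_sub (h2.const_mul 2) i1, e1, e2,
    integral_const_mul]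
  ring

theorem aux_bound {f : ℝ → ℝ} (h0 : Integrable f) (h2 : Integrable fun x => x ^ 2 * f x)
    (a : ℝ) (ha : 1 ≤ a ^ 2) : ∫ x, ‖x ^ 2 * (2 * f x - f (x + a) - f (x - a))‖ ≤
    (4 * (∫ x, x ^ 2 * |f x|) + 2 * ∫ x, |f x|) * a ^ 2 := by
  have g0 : Integrable fun x => |f x| := h0.abs
  have g2 : Integrable fun x => x ^ 2 * |f x| := by
    simpa [abs_mul] using h2.abs
  obtain ⟨i1, e1⟩ := aux_shift g0 g2 a
  obtain ⟨i2, e2⟩ := aux_shift g0 g2 (-a)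
  have hp : 0 ≤ ∫ x, x ^ 2 * |f x| := integral_nonneg fun x => by positivity
  calc _ ≤ ∫ x, (2 * (x ^ 2 * |f x|) + x ^ 2 * |f (x + a)| + x ^ 2 * |f (x + -a)|) := by
        refine integral_mono (aux_second h0 h2 a).1.norm
          (((g2.const_mul 2).add i1).add i2) fun x => ?_
        simp only [Real.norm_eq_abs, abs_mul, abs_pow, sq_abs, ← sub_eq_add_neg]
        have := abs_sub (2 * f x - f (x + a)) (f (x - a))
        have h3 := abs_sub (2 * f x) (f (x + a))
        rw [abs_mul, abs_two] at h3
        nlinarith [sq_nonneg x]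
    _ = 4 * (∫ x, x ^ 2 * |f x|) + 2 * (∫ x, |f x|) * a ^ 2 := by
        have hj : Integrable fun x => 2 * (x ^ 2 * |f x|) + x ^ 2 * |f (x + a)| :=
          (g2.const_mul 2).add i1
        rw [integral_add hj i2, integral_add (g2.const_mul 2) i1, e1, e2,
          integral_const_mul]
        ring
    _ ≤ _ := by nlinarith

/-- Integral identity for solitary traveling waves: if the profile `φ` solves the
advance-delay equation with nearest-neighbor force `W` and long-range coefficients `Λ`,
with suitable integrability, summability and decay, then
`(c² − Σ_{m≥1} m²Λ(m)) ∫φ = ∫W(φ)`. -/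
theorem stmt_13 (c : ℝ) (hc : c ≠ 0) (W : ℝ → ℝ) (φ : ℝ → ℝ) (Λ : ℕ → ℝ)
    (hφ : ContDiff ℝ 2 φ)
    (hint1 : Integrable (fun ξ : ℝ => (1 + ξ ^ 2) * φ ξ))
    (hint2 : Integrable (fun ξ : ℝ => W (φ ξ)))
    (hint3 : Integrable (fun ξ : ℝ => ξ ^ 2 * W (φ ξ)))
    (hΛ : Summable (fun m : ℕ => ((m : ℝ) + 1) ^ 2 * |Λ (m + 1)|))
    (hlim1 : Tendsto (fun ξ : ℝ => ξ * φ ξ) atTop (𝓝 0))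
    (hlim2 : Tendsto (fun ξ : ℝ => ξ * φ ξ) atBot (𝓝 0))
    (hlim3 : Tendsto (fun ξ : ℝ => ξ ^ 2 * deriv φ ξ) atTop (𝓝 0))
    (hlim4 : Tendsto (fun ξ : ℝ => ξ ^ 2 * deriv φ ξ) atBot (𝓝 0))
    (heq : ∀ ξ : ℝ,
      c ^ 2 * deriv (deriv φ) ξ + 2 * W (φ ξ) - W (φ (ξ + 1)) - W (φ (ξ - 1)) +
        ∑' m : ℕ, Λ (m + 1) * (2 * φ ξ - φ (ξ + ((m : ℝ) + 1)) - φ (ξ - ((m : ℝ) + 1))) = 0) :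
    (c ^ 2 - ∑' m : ℕ, ((m : ℝ) + 1) ^ 2 * Λ (m + 1)) * (∫ ξ : ℝ, φ ξ)
      = ∫ ξ : ℝ, W (φ ξ) := by
  have hcφ : Continuous φ := hφ.continuous
  have p0 : Integrable φ := by
    refine hint1.mono hcφ.aestronglyMeasurable (Eventually.of_forall fun x => ?_)
    rw [norm_mul, Real.norm_eq_abs (1 + x ^ 2), abs_of_pos (by positivity)]
    nlinarith [mul_nonneg (sq_nonneg x) (norm_nonneg (φ x))]
  have p2 : Integrable fun x => x ^ 2 * φ x := by
    refine (hint1.sub p0).congr (Eventually.of_forall fun x => ?_)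
    simp only [Pi.sub_apply]; ring
  have hd1 : ∀ x, HasDerivAt φ (deriv φ x) x := fun x =>
    (hφ.differentiable (by norm_num) x).hasDerivAt
  have hφ' : ContDiff ℝ 1 (deriv φ) := by
    have : ContDiff ℝ (1 + 1) φ := by simpa [one_add_one_eq_two] using hφ
    exact (contDiff_succ_iff_deriv.1 this).2.2
  have hd2 : ∀ x, HasDerivAt (deriv φ) (deriv (deriv φ) x) x := fun x =>
    (hφ'.differentiable (by norm_num) x).hasDerivAt
  have hc2 : Continuous (deriv (deriv φ)) := hφ'.continuous_deriv (by norm_num)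
  obtain ⟨w1, w2⟩ := aux_second hint2 hint3 1
  let F : ℕ → ℝ → ℝ := fun m ξ =>
    Λ (m + 1) * (ξ ^ 2 * (2 * φ ξ - φ (ξ + ((m : ℝ) + 1)) - φ (ξ - ((m : ℝ) + 1))))
  have hF : ∀ m, Integrable (F m) := fun m => (aux_second p0 p2 ((m : ℝ) + 1)).1.const_mul _
  have hFi : ∀ m, ∫ ξ, F m ξ = (((m : ℝ) + 1) ^ 2 * Λ (m + 1)) * (-2 * ∫ x, φ x) := fun m => by
    simp only [F]
    rw [integral_const_mul, (aux_second p0 p2 ((m : ℝ) + 1)).2]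
    ring
  have hs : Summable fun m => ∫ ξ, ‖F m ξ‖ := by
    refine Summable.of_nonneg_of_le (fun m => integral_nonneg fun x => norm_nonneg _) (fun m => ?_)
      (hΛ.mul_left (4 * (∫ x, x ^ 2 * |φ x|) + 2 * ∫ x, |φ x|))
    have hm : (1 : ℝ) ≤ ((m : ℝ) + 1) ^ 2 := by
      have : (0 : ℝ) ≤ m := Nat.cast_nonneg m
      nlinarith
    have hb := aux_bound p0 p2 ((m : ℝ) + 1) hm
    simp only [F]
    simp_rw [norm_mul (Λ (m + 1))]
    rw [integral_const_mul, Real.norm_eq_abs]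
    have := mul_le_mul_of_nonneg_left hb (abs_nonneg (Λ (m + 1)))
    refine this.trans (le_of_eq ?_)
    ring
  have hFeq : ∀ ξ, ∑' m, F m ξ = -(c ^ 2 * (ξ ^ 2 * deriv (deriv φ) ξ)) -
      ξ ^ 2 * (2 * W (φ ξ) - W (φ (ξ + 1)) - W (φ (ξ - 1))) := fun ξ => by
    have h := heq ξ
    have : ∑' m, F m ξ = ξ ^ 2 * ∑' m : ℕ, Λ (m + 1) *
        (2 * φ ξ - φ (ξ + ((m : ℝ) + 1)) - φ (ξ - ((m : ℝ) + 1))) := by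
      rw [← tsum_mul_left]
      exact tsum_congr fun m => by simp only [F]; ring
    rw [this]
    linear_combination ξ ^ 2 * h
  have hcont : Continuous fun ξ => ξ ^ 2 * deriv (deriv φ) ξ := by fun_prop
  have hT : Integrable fun ξ => ∑' m, F m ξ := by
    refine aux_tsum hF hs ?_
    rw [funext hFeq]
    exact ((hcont.const_mul _).neg.aestronglyMeasurable).sub w1.1
  have hI : Integrable fun ξ => ξ ^ 2 * deriv (deriv φ) ξ := by
    refine ((hT.add w1).const_mul (-(c ^ 2)⁻¹)).congr (Eventually.of_forall fun ξ => ?_)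
    simp only [Pi.add_apply]
    rw [hFeq]
    field_simp
    ring
  have hparts : ∫ ξ, (ξ ^ 2 * deriv (deriv φ) ξ - 2 * φ ξ) = 0 - 0 := by
    refine integral_of_hasDerivAt_of_tendsto
      (f := fun ξ => ξ ^ 2 * deriv φ ξ - 2 * (ξ * φ ξ)) (fun x => ?_)
      (hI.sub (p0.const_mul 2)) ?_ ?_
    · have := ((hasDerivAt_pow 2 x).mul (hd2 x)).sub
        (((hasDerivAt_id x).mul (hd1 x)).const_mul 2)
      refine this.congr_deriv ?_
      simp
      ring
    · simpa using hlim4.sub (hlim2.const_mul 2)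
    · simpa using hlim3.sub (hlim1.const_mul 2)
  rw [integral_sub hI (p0.const_mul 2), integral_const_mul] at hparts
  have hsum := integral_tsum_of_summable_integral_norm hF hs
  have hj : Integrable fun ξ => -(c ^ 2 * (ξ ^ 2 * deriv (deriv φ) ξ)) := (hI.const_mul _).neg
  rw [tsum_congr hFi, tsum_mul_right, funext hFeq,
    integral_sub hj w1, integral_neg, integral_const_mul, w2] at hsum
  linear_combination (1 / 2) * hsum - (c ^ 2 / 2) * hparts
end

section
/- Let V be a finite-dimensional real inner product space and let J, L : V → V be linear maps such that J is bijective, ⟨Jx, y⟩ = −⟨x, Jy⟩ for all x, y ∈ V, and ⟨J(Lx), y⟩ = ⟨x, J(Ly)⟩ for all x, y ∈ V. Suppose e₀ ∈ V is nonzero with L e₀ = 0 and the kernel of L equals the span of e₀, and suppose e₁ ∈ V satisfies L e₁ = e₀. Then: (a) there exists e₂ ∈ V with L e₂ = e₁ if and only if ⟨e₁, J e₀⟩ = 0; and (b) for every e₂ ∈ V with L e₂ = e₁ there exists e₃ ∈ V with L e₃ = e₂. -/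
open scoped RealInnerProductSpace

/-- For the linearization of a Hamiltonian system (`J` bijective skew-adjoint, `J ∘ L`
self-adjoint) with one-dimensional kernel spanned by `e₀` and `L e₁ = e₀`:
(a) a third chain vector `e₂` with `L e₂ = e₁` exists iff `⟪e₁, J e₀⟫ = 0`, and
(b) whenever such an `e₂` exists, a fourth chain vector `e₃` with `L e₃ = e₂` exists. -/
theorem stmt_17 {V : Type*} [NormedAddCommGroup V] [InnerProductSpace ℝ V]
    [FiniteDimensional ℝ V]
    (J L : V →ₗ[ℝ] V) (hJbij : Function.Bijective J)
    (hJ : ∀ x y : V, ⟪J x, y⟫ = -⟪x, J y⟫)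
    (hJL : ∀ x y : V, ⟪J (L x), y⟫ = ⟪x, J (L y)⟫)
    (e₀ : V) (he₀ : e₀ ≠ 0) (hLe₀ : L e₀ = 0)
    (hker : LinearMap.ker L = Submodule.span ℝ {e₀})
    (e₁ : V) (hLe₁ : L e₁ = e₀) :
    ((∃ e₂ : V, L e₂ = e₁) ↔ ⟪e₁, J e₀⟫ = 0) ∧
      (∀ e₂ : V, L e₂ = e₁ → ∃ e₃ : V, L e₃ = e₂) := by
  have key : ∀ y : V, (∃ x, L x = y) ↔ ⟪y, J e₀⟫ = 0 := by
    intro y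
    constructor
    · rintro ⟨x, rfl⟩
      have h1 := hJ (L x) e₀
      have h2 := hJL x e₀
      rw [hLe₀, map_zero, inner_zero_right] at h2
      linarith
    · intro hy
      have hmem : y ∈ (LinearMap.range L)ᗮᗮ := by
        rw [Submodule.mem_orthogonal]
        intro w hw
        obtain ⟨u, rfl⟩ := hJbij.2 w
        rw [Submodule.mem_orthogonal] at hw
        have hz : J (L u) = 0 := by
          rw [← inner_self_eq_zero (𝕜 := ℝ)]
          have h1 := hw (L (J (L u))) ⟨_, rfl⟩
          have h2 := hJ (L (J (L u))) u
          have h3 := hJL (J (L u)) u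
          linarith
        have hu : L u = 0 := hJbij.1 (by rw [hz, map_zero])
        have hu' : u ∈ Submodule.span ℝ {e₀} := by
          rw [← hker]; exact hu
        obtain ⟨c, rfl⟩ := Submodule.mem_span_singleton.1 hu'
        rw [map_smul, real_inner_smul_left, real_inner_comm, hy, mul_zero]
      rw [Submodule.orthogonal_orthogonal] at hmem
      exact hmem
  refine ⟨key e₁, fun e₂ h₂ => (key e₂).2 ?_⟩
  have h1 := hJL e₂ e₁
  have h2 := hJ e₁ e₁
  rw [h₂, hLe₁] at h1
  rw [real_inner_comm (J e₁) e₁] at h2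
  have h3 := real_inner_comm (J e₁) e₁
  linarith
end
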